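/- arXiv:1503.00153 — 7 statements merged into one kernel-verified Lean document; each statement's English description precedes it below -/
import Mathlib

section
/- Spectral gap comparison under change of routing: assume that for every D ⊆ J̃ the matrix R′^D − R^D is positive semidefinite in L²(ξ^D), i.e. Σ_{j∈J̃₀∖D} ξ^D_j u_j Σ_{i∈J̃₀∖D} (r′^D_{ji} − r^D_{ji}) u_i ≥ 0 for every vector u = (u_j)_{j∈J̃₀∖D}. Then Gap(Q^{Z′}) ≤ Gap(Q^Z). -/
open scoped BigOperators

noncomputable section

namespace UnrelNet

/-- State space of the unreliable Jackson network: a set of broken-down nodes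
together with a queue-length vector. -/
abbrev Est (J : ℕ) := Finset (Fin J) × (Fin J → ℕ)

/-- The extended node set `J̃₀ ∖ D`: the exterior node `none` together with
the up nodes (complement of `D`). -/
def ext (J : ℕ) (D : Finset (Fin J)) : Finset (Option (Fin J)) :=
  insert none (Dᶜ.image Option.some)

/-- Unit vector `e_j` of `ℕ^J̃`, with `e_0 = 0` (index `none`). -/
def eV {J : ℕ} (o : Option (Fin J)) : Fin J → ℕ := fun i =>
  match o with
  | none => 0
  | some j => if i = j then 1 else 0

/-- Breakdown/repair generator `Q^Y`. -/
def QY {J : ℕ} (A B : Finset (Fin J) → ℝ) (f : Finset (Fin J) → ℝ)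
    (D : Finset (Fin J)) : ℝ :=
  (∑ H ∈ Finset.univ.filter (fun H => H ⊂ D), B D / B H * (f H - f D))
    + ∑ I ∈ Finset.univ.filter (fun I => D ⊂ I), A I / A D * (f I - f D)

/-- Off-diagonal breakdown/repair rates. -/
def qY0 {J : ℕ} (A B : Finset (Fin J) → ℝ) (D E : Finset (Fin J)) : ℝ :=
  if D ⊂ E then A E / A D else if E ⊂ D then B D / B E else 0

/-- Breakdown/repair rate matrix `q^Y`, including the diagonal. -/
def qY {J : ℕ} (A B : Finset (Fin J) → ℝ) (D E : Finset (Fin J)) : ℝ :=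
  if E = D then -∑ F, qY0 A B D F else qY0 A B D E

/-- Breakdown/repair generator written via the rate matrix. -/
def QYm {J : ℕ} (A B : Finset (Fin J) → ℝ) (f : Finset (Fin J) → ℝ)
    (D : Finset (Fin J)) : ℝ :=
  ∑ E, qY A B D E * f E

/-- Normalisation constant `Ĉ`. -/
def Chat {J : ℕ} (A B : Finset (Fin J) → ℝ) : ℝ := ∑ D, A D / B D

/-- Stationary distribution `π̂` of the breakdown/repair process. -/
def piY {J : ℕ} (A B : Finset (Fin J) → ℝ) (D : Finset (Fin J)) : ℝ :=
  (A D / B D) / Chat A B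

/-- `Π_{i=1}^{k} η_j/μ_j(i)`. -/
def prodK {J : ℕ} (η : Fin J → ℝ) (μ : Fin J → ℕ → ℝ) (j : Fin J) (k : ℕ) : ℝ :=
  ∏ i ∈ Finset.range k, η j / μ j (i + 1)

/-- Normalisation constant `C_j`. -/
def Cnorm {J : ℕ} (η : Fin J → ℝ) (μ : Fin J → ℕ → ℝ) (j : Fin J) : ℝ :=
  ∑' k : ℕ, prodK η μ j k

/-- Product-form stationary distribution `π` of the Jackson network. -/
def piX {J : ℕ} (η : Fin J → ℝ) (μ : Fin J → ℕ → ℝ) (n : Fin J → ℕ) : ℝ :=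
  ∏ j, prodK η μ j (n j) / Cnorm η μ j

/-- Product measure `π̃(D,n) = π̂(D)·π(n)`. -/
def piZ {J : ℕ} (η : Fin J → ℝ) (μ : Fin J → ℕ → ℝ) (A B : Finset (Fin J) → ℝ)
    (x : Est J) : ℝ :=
  piY A B x.1 * piX η μ x.2

/-- Generator `Q^Z` of the unreliable Jackson network. -/
def QZ {J : ℕ} (lam : ℝ) (μ : Fin J → ℕ → ℝ)
    (r : Finset (Fin J) → Option (Fin J) → Option (Fin J) → ℝ)
    (A B : Finset (Fin J) → ℝ) (f : Est J → ℝ) (x : Est J) : ℝ :=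
  (∑ j ∈ x.1ᶜ, lam * r x.1 none (some j) * (f (x.1, x.2 + eV (some j)) - f x))
    + (∑ j ∈ x.1ᶜ, μ j (x.2 j) * r x.1 (some j) none * (f (x.1, x.2 - eV (some j)) - f x))
    + (∑ j ∈ x.1ᶜ, ∑ i ∈ x.1ᶜ,
        μ j (x.2 j) * r x.1 (some j) (some i) * (f (x.1, x.2 - eV (some j) + eV (some i)) - f x))
    + (∑ H ∈ Finset.univ.filter (fun H => H ⊂ x.1), B x.1 / B H * (f (H, x.2) - f x))
    + ∑ I ∈ Finset.univ.filter (fun I => x.1 ⊂ I), A I / A x.1 * (f (I, x.2) - f x)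

/-- Transition-rate matrix `q^Z` of the unreliable Jackson network
(between distinct states; the diagonal is set to `0`). -/
def qZ {J : ℕ} (lam : ℝ) (μ : Fin J → ℕ → ℝ)
    (r : Finset (Fin J) → Option (Fin J) → Option (Fin J) → ℝ)
    (A B : Finset (Fin J) → ℝ) (x y : Est J) : ℝ :=
  if x = y then 0
  else
    (if y.1 = x.1 then
        ∑ j ∈ x.1ᶜ,
          ((if y.2 = x.2 + eV (some j) then lam * r x.1 none (some j) else 0)
            + (if y.2 + eV (some j) = x.2 then μ j (x.2 j) * r x.1 (some j) none else 0)
            + ∑ i ∈ x.1ᶜ,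
                if i ≠ j ∧ y.2 + eV (some j) = x.2 + eV (some i) then
                  μ j (x.2 j) * r x.1 (some j) (some i)
                else 0)
      else 0)
    + (if y.2 = x.2 then
        (if y.1 ⊂ x.1 then B x.1 / B y.1 else 0) + (if x.1 ⊂ y.1 then A y.1 / A x.1 else 0)
      else 0)

/-- Extension `η^D` of the traffic solution: `η^D_0 = λ`, `η^D_j = η_j`. -/
def etaE {J : ℕ} (lam : ℝ) (η : Fin J → ℝ) : Option (Fin J) → ℝ := fun o => o.elim lam η

/-- Normalised routing-equilibrium vector `ξ^D`. -/
def xiV {J : ℕ} (lam : ℝ) (η : Fin J → ℝ) (D : Finset (Fin J))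
    (o : Option (Fin J)) : ℝ :=
  etaE lam η o / ∑ k ∈ ext J D, etaE lam η k

/-- Spectral gap of a generator on the network state space w.r.t. a measure `m`. -/
def GapZ {J : ℕ} (m : Est J → ℝ) (Q : (Est J → ℝ) → Est J → ℝ) : ℝ :=
  sInf {v : ℝ | ∃ f : Est J → ℝ,
    Summable (fun x => f x * f x * m x) ∧ (∑' x, f x * m x) = 0 ∧
      (∑' x, f x * f x * m x) = 1 ∧ v = ∑' x, f x * -(Q f x) * m x}

/-- Spectral gap of a generator on `2^{J̃}` w.r.t. a probability vector `m`. -/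
def GapY {J : ℕ} (m : Finset (Fin J) → ℝ)
    (Q : (Finset (Fin J) → ℝ) → Finset (Fin J) → ℝ) : ℝ :=
  sInf {v : ℝ | ∃ f : Finset (Fin J) → ℝ,
    (∑ D, m D * f D) = 0 ∧ (∑ D, m D * f D ^ 2) = 1 ∧
      v = -(∑ D, m D * f D * Q f D)}

/-- Merge a vector indexed by `D` with a vector indexed by `J̃∖D`. -/
def merge {J : ℕ} (D : Finset (Fin J)) (a : {j : Fin J // j ∈ D} → ℕ)
    (b : {j : Fin J // j ∉ D} → ℕ) : Fin J → ℕ := fun j =>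
  if h : j ∈ D then a ⟨j, h⟩ else b ⟨j, h⟩

/-- Marginal product-form density on a sub-collection of nodes. -/
def piSub {J : ℕ} (η : Fin J → ℝ) (μ : Fin J → ℕ → ℝ) (p : Fin J → Prop)
    [DecidablePred p] (a : {j : Fin J // p j} → ℕ) : ℝ :=
  ∏ j : {j : Fin J // p j}, prodK η μ j.1 (a j) / Cnorm η μ j.1

/-- Unit vector on a subtype index set. -/
def eS {J : ℕ} {p : Fin J → Prop} (j : {k : Fin J // p k}) :
    {k : Fin J // p k} → ℕ := fun i => if i = j then 1 else 0

/-- Generator of the synthetic subnetwork on the up nodes `J̃∖D`. -/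
def QXsub {J : ℕ} (lam : ℝ) (μ : Fin J → ℕ → ℝ)
    (r : Finset (Fin J) → Option (Fin J) → Option (Fin J) → ℝ)
    (D : Finset (Fin J)) (h : ({j : Fin J // j ∉ D} → ℕ) → ℝ)
    (m : {j : Fin J // j ∉ D} → ℕ) : ℝ :=
  (∑ j : {j : Fin J // j ∉ D}, lam * r D none (some j.1) * (h (m + eS j) - h m))
    + (∑ j : {j : Fin J // j ∉ D}, μ j.1 (m j) * r D (some j.1) none * (h (m - eS j) - h m))
    + ∑ j : {j : Fin J // j ∉ D}, ∑ i : {j : Fin J // j ∉ D},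
        μ j.1 (m j) * r D (some j.1) (some i.1) * (h (m - eS j + eS i) - h m)

/-- Transition-rate matrix `q^X` of the (reliable) Jackson network. -/
def qX {J : ℕ} (lam : ℝ) (μ : Fin J → ℕ → ℝ)
    (r : Option (Fin J) → Option (Fin J) → ℝ) (n m : Fin J → ℕ) : ℝ :=
  if n = m then 0
  else
    ∑ j : Fin J,
      ((if m = n + eV (some j) then lam * r none (some j) else 0)
        + (if m + eV (some j) = n then μ j (n j) * r (some j) none else 0)
        + ∑ i : Fin J,
            if i ≠ j ∧ m + eV (some j) = n + eV (some i) then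
              μ j (n j) * r (some j) (some i)
            else 0)

/-- One-step Markov operator `K = Id + ε·Q`. -/
def Kop {J : ℕ} (ε : ℝ) (Q : (Est J → ℝ) → Est J → ℝ) :
    (Est J → ℝ) → Est J → ℝ := fun h x => h x + ε * Q h x

section Helpers

variable {J : ℕ}

def rate (lam : ℝ) (μ : Fin J → ℕ → ℝ) (o : Option (Fin J)) (n : Fin J → ℕ) : ℝ :=
  o.elim lam (fun j => μ j (n j))

def cc (r : Finset (Fin J) → Option (Fin J) → Option (Fin J) → ℝ)
    (D : Finset (Fin J)) (o p : Option (Fin J)) : ℝ :=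
  if o ∈ ext J D ∧ p ∈ ext J D then r D o p else 0

def phi (o p : Option (Fin J)) (x : Est J) : Est J := (x.1, x.2 - eV o + eV p)

def bb (A B : Finset (Fin J) → ℝ) (D H : Finset (Fin J)) (x : Est J) : ℝ :=
  if x.1 = D then qY0 A B D H else 0

theorem eV_none : (eV none : Fin J → ℕ) = 0 := rfl

theorem some_mem_ext (D : Finset (Fin J)) (j : Fin J) : some j ∈ ext J D ↔ j ∈ Dᶜ := by
  simp [ext]

theorem none_mem_ext (D : Finset (Fin J)) : none ∈ ext J D := by
  simp [ext]

theorem qY0_sum (A B f : Finset (Fin J) → ℝ) (D : Finset (Fin J)) (c : ℝ) :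
    ∑ H, qY0 A B D H * (f H - c) =
      (∑ H ∈ Finset.univ.filter (fun H => H ⊂ D), B D / B H * (f H - c))
      + ∑ I ∈ Finset.univ.filter (fun I => D ⊂ I), A I / A D * (f I - c) := by
  rw [Finset.sum_filter, Finset.sum_filter, ← Finset.sum_add_distrib]
  refine Finset.sum_congr rfl fun H _ => ?_
  unfold qY0
  by_cases h1 : D ⊂ H
  · have h2 : ¬ H ⊂ D := fun h => (h1.trans h).ne rfl
    simp [h1, h2]
  · by_cases h2 : H ⊂ D <;> simp [h1, h2]

theorem QZ_eq (lam : ℝ) (μ : Fin J → ℕ → ℝ)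
    (r : Finset (Fin J) → Option (Fin J) → Option (Fin J) → ℝ)
    (A B : Finset (Fin J) → ℝ) (f : Est J → ℝ) (x : Est J) :
    QZ lam μ r A B f x =
      (∑ o, ∑ p, rate lam μ o x.2 * cc r x.1 o p * (f (phi o p x) - f x))
      + ∑ D, ∑ H, bb A B D H x * (f (H, x.2) - f x) := by
  have h2 : ∑ D, ∑ H, bb A B D H x * (f (H, x.2) - f x)
      = ∑ H, qY0 A B x.1 H * (f (H, x.2) - f x) := by
    rw [Finset.sum_eq_single x.1]
    · simp [bb]
    · intro D _ hD
      simp [bb, hD.symm]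
    · simp
  rw [h2, qY0_sum A B (fun H => f (H, x.2))]
  unfold QZ
  rw [← add_assoc]
  congr 2
  have key : ∀ (s : Finset (Fin J)) (g : Fin J → ℝ),
      ∑ j ∈ s, g j = ∑ j, if j ∈ s then g j else 0 := by
    intro s g; simp
  rw [Fintype.sum_option, Fintype.sum_option]
  simp_rw [Fintype.sum_option]
  rw [Finset.sum_add_distrib]
  have e0 : rate lam μ none x.2 * cc r x.1 none none * (f (phi none none x) - f x) = 0 := by
    simp [phi, eV_none]
  rw [e0, zero_add, ← add_assoc]
  congr 1
  · congr 1
    · rw [key]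
      refine Finset.sum_congr rfl fun j _ => ?_
      simp only [rate, cc, some_mem_ext, none_mem_ext, phi, eV_none, true_and, Option.elim]
      split_ifs <;> simp
    · rw [key]
      refine Finset.sum_congr rfl fun j _ => ?_
      simp only [rate, cc, some_mem_ext, none_mem_ext, phi, eV_none, and_true, Option.elim]
      split_ifs <;> simp
  · rw [key]
    refine Finset.sum_congr rfl fun j _ => ?_
    by_cases hj : j ∈ x.1ᶜ
    · rw [if_pos hj, key]
      refine Finset.sum_congr rfl fun i _ => ?_
      simp only [rate, cc, some_mem_ext, phi, Option.elim, hj, true_and]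
      split_ifs <;> simp
    · rw [if_neg hj]
      symm
      refine Finset.sum_eq_zero fun i _ => ?_
      simp only [cc, some_mem_ext, hj, false_and, if_false]
      simp

theorem prodK_nonneg' (η : Fin J → ℝ) (hη : ∀ j, 0 < η j) (μ : Fin J → ℕ → ℝ)
    (hμpos : ∀ j k, k ≠ 0 → 0 < μ j k) (j : Fin J) (k : ℕ) : 0 ≤ prodK η μ j k :=
  Finset.prod_nonneg fun i _ => (div_pos (hη j) (hμpos j (i+1) (by simp))).le

theorem piX_nonneg' (η : Fin J → ℝ) (hη : ∀ j, 0 < η j) (μ : Fin J → ℕ → ℝ)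
    (hμpos : ∀ j k, k ≠ 0 → 0 < μ j k) (n : Fin J → ℕ) : 0 ≤ piX η μ n :=
  Finset.prod_nonneg fun j _ => div_nonneg (prodK_nonneg' η hη μ hμpos j _)
    (tsum_nonneg fun k => prodK_nonneg' η hη μ hμpos j k)

theorem piY_nonneg' (A B : Finset (Fin J) → ℝ)
    (hApos : ∀ D, 0 < A D) (hBpos : ∀ D, 0 < B D) (D : Finset (Fin J)) : 0 < piY A B D :=
  div_pos (div_pos (hApos D) (hBpos D))
    (Finset.sum_pos (fun D _ => (div_pos (hApos D) (hBpos D))) ⟨∅, by simp⟩)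

theorem rate_piX (lam : ℝ) (η : Fin J → ℝ) (μ : Fin J → ℕ → ℝ)
    (hμpos : ∀ j k, k ≠ 0 → 0 < μ j k) (o : Option (Fin J)) (m : Fin J → ℕ) :
    rate lam μ o (m + eV o) * piX η μ (m + eV o) = etaE lam η o * piX η μ m := by
  cases o with
  | none => simp [rate, etaE, eV_none]
  | some j =>
    unfold piX
    rw [← Finset.mul_prod_erase _ _ (Finset.mem_univ j),
      ← Finset.mul_prod_erase Finset.univ (fun i => prodK η μ i (m i) / Cnorm η μ i)
        (Finset.mem_univ j)]
    have h1 : ∏ i ∈ Finset.univ.erase j, prodK η μ i ((m + eV (some j)) i) / Cnorm η μ i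
        = ∏ i ∈ Finset.univ.erase j, prodK η μ i (m i) / Cnorm η μ i := by
      refine Finset.prod_congr rfl fun i hi => ?_
      have : i ≠ j := Finset.ne_of_mem_erase hi
      simp [eV, this]
    rw [h1]
    have h2 : (m + eV (some j)) j = m j + 1 := by simp [eV]
    simp only [rate, etaE, Option.elim, h2]
    have h3 : prodK η μ j (m j + 1) = prodK η μ j (m j) * (η j / μ j (m j + 1)) := by
      unfold prodK; rw [Finset.prod_range_succ]
    have h4 : μ j (m j + 1) ≠ 0 := (hμpos j _ (by simp)).ne'
    rw [h3]
    field_simp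

theorem sub_add_eV (lam : ℝ) (μ : Fin J → ℕ → ℝ) (hμ0 : ∀ j, μ j 0 = 0)
    (o : Option (Fin J)) (n : Fin J → ℕ) (h : rate lam μ o n ≠ 0) :
    n - eV o + eV o = n := by
  cases o with
  | none => simp [eV_none]
  | some j =>
    ext i
    simp only [Pi.add_apply, Pi.sub_apply, eV]
    split_ifs with hi
    · subst hi
      have : n i ≠ 0 := by
        intro h0; apply h; simp [rate, h0, hμ0]
      omega
    · simp

/-- general comparison -/
theorem genL {X : Type*} (m f w : X → ℝ) (φ : X → X) (C : ℝ)
    (hm : ∀ x, 0 ≤ m x) (hw : ∀ x, 0 ≤ w x) (hC : 0 ≤ C)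
    (hinj : Set.InjOn φ (Function.support w))
    (hle : ∀ x, w x * m x ≤ C * m (φ x))
    (hf : Summable fun x => f x * f x * m x) :
    Summable (fun x => w x * (f (φ x) * f (φ x)) * m x) ∧
      ∑' x, w x * (f (φ x) * f (φ x)) * m x ≤ C * ∑' x, f x * f x * m x := by
  set S := Function.support w
  set F : X → ℝ := fun x => f x * f x * m x with hF
  have hF0 : ∀ x, 0 ≤ F x := fun x => mul_nonneg (mul_self_nonneg _) (hm x)
  set G : X → ℝ := fun x => w x * (f (φ x) * f (φ x)) * m x with hG
  have hG0 : ∀ x, 0 ≤ G x := fun x =>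
    mul_nonneg (mul_nonneg (hw x) (mul_self_nonneg _)) (hm x)
  have hsup : Function.support G ⊆ S := by
    intro x hx hw0
    apply hx
    simp only [hG]
    rw [show w x = 0 from hw0]; ring
  have hinj' : Function.Injective (fun x : S => φ x) := fun a b hab =>
    Subtype.ext (hinj a.2 b.2 hab)
  have hs1 : Summable fun x : S => F (φ x) := hf.comp_injective hinj'
  have hGF : ∀ x, G x ≤ C * F (φ x) := by
    intro x
    have := mul_le_mul_of_nonneg_left (hle x) (mul_self_nonneg (f (φ x)))
    simp only [hG, hF]
    linarith
  have hs2 : Summable fun x : S => G x :=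
    Summable.of_nonneg_of_le (fun x => hG0 x) (fun x => hGF x) (hs1.mul_left C)
  have hs3 : Summable G := by
    have : Summable (S.indicator G) := summable_subtype_iff_indicator.mp hs2
    rwa [Set.indicator_eq_self.mpr hsup] at this
  refine ⟨hs3, ?_⟩
  rw [← tsum_subtype_eq_of_support_subset hsup]
  calc ∑' x : S, G x ≤ ∑' x : S, C * F (φ x) := hs2.tsum_le_tsum (fun x => hGF x) (hs1.mul_left C)
    _ = C * ∑' x : S, F (φ x) := tsum_mul_left
    _ ≤ C * ∑' x, F x := by
      refine mul_le_mul_of_nonneg_left ?_ hC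
      exact tsum_comp_le_tsum_of_inj hf hF0 hinj'

theorem genS {X : Type*} (m f w : X → ℝ) (φ : X → X) (C K : ℝ)
    (hm : ∀ x, 0 ≤ m x) (hw : ∀ x, 0 ≤ w x) (hC : 0 ≤ C)
    (hinj : Set.InjOn φ (Function.support w))
    (hle : ∀ x, w x * m x ≤ C * m (φ x)) (hK : ∀ x, w x ≤ K)
    (hf : Summable fun x => f x * f x * m x) :
    Summable (fun x => w x * (f x * f (φ x)) * m x) := by
  have h1 := (genL m f w φ C hm hw hC hinj hle hf).1
  refine Summable.of_norm_bounded ((hf.mul_left K).add h1) fun x => ?_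
  rw [Real.norm_eq_abs, abs_mul, abs_mul, abs_of_nonneg (hm x), abs_of_nonneg (hw x)]
  have h2 : |f x * f (φ x)| ≤ f x * f x + f (φ x) * f (φ x) := by
    rw [abs_le]; constructor <;> nlinarith [sq_nonneg (f x + f (φ x)), sq_nonneg (f x - f (φ x)),
      sq_nonneg (f x), sq_nonneg (f (φ x))]
  have h3 := mul_le_mul_of_nonneg_left h2 (mul_nonneg (hw x) (hm x))
  have h4 : w x * (f x * f x * m x) ≤ K * (f x * f x * m x) :=
    mul_le_mul_of_nonneg_right (hK x) (mul_nonneg (mul_self_nonneg _) (hm x))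
  nlinarith

theorem jump_injOn (lam : ℝ) (μ : Fin J → ℕ → ℝ) (hμ0 : ∀ j, μ j 0 = 0)
    (o p : Option (Fin J)) (a : Finset (Fin J) → ℝ) :
    Set.InjOn (phi o p) (Function.support fun x : Est J => rate lam μ o x.2 * a x.1) := by
  rintro ⟨D, n⟩ hx ⟨D', n'⟩ hy h
  have hx' := sub_add_eV lam μ hμ0 o n (left_ne_zero_of_mul hx)
  have hy' := sub_add_eV lam μ hμ0 o n' (left_ne_zero_of_mul hy)
  simp only [phi, Prod.mk.injEq] at h
  have h2 := add_right_cancel h.2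
  rw [h2, hy'] at hx'
  rw [h.1, hx']

theorem rate_nonneg (lam : ℝ) (hlam : 0 < lam) (μ : Fin J → ℕ → ℝ) (hμ0 : ∀ j, μ j 0 = 0)
    (hμpos : ∀ j k, k ≠ 0 → 0 < μ j k) (o : Option (Fin J)) (n : Fin J → ℕ) :
    0 ≤ rate lam μ o n := by
  cases o with
  | none => exact hlam.le
  | some j =>
    by_cases h : n j = 0
    · simp [rate, h, hμ0]
    · exact (hμpos j _ h).le

theorem etaE_pos (lam : ℝ) (hlam : 0 < lam) (η : Fin J → ℝ) (hη : ∀ j, 0 < η j)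
    (o : Option (Fin J)) : 0 < etaE lam η o := by
  cases o with
  | none => exact hlam
  | some j => exact hη j

theorem jump_le (lam : ℝ) (hlam : 0 < lam) (μ : Fin J → ℕ → ℝ) (hμ0 : ∀ j, μ j 0 = 0)
    (hμpos : ∀ j k, k ≠ 0 → 0 < μ j k) (K : ℝ) (hK : ∀ o n, rate lam μ o n ≤ K)
    (η : Fin J → ℝ) (hη : ∀ j, 0 < η j) (A B : Finset (Fin J) → ℝ)
    (hApos : ∀ D, 0 < A D) (hBpos : ∀ D, 0 < B D)
    (o p : Option (Fin J)) (a : Finset (Fin J) → ℝ) (ha : ∀ D, 0 ≤ a D) (ha1 : ∀ D, a D ≤ 1)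
    (x : Est J) :
    rate lam μ o x.2 * a x.1 * piZ η μ A B x
      ≤ (etaE lam η o / etaE lam η p * K) * piZ η μ A B (phi o p x) := by
  obtain ⟨D, n⟩ := x
  have hp := piX_nonneg' η hη μ hμpos
  have hY := piY_nonneg' A B hApos hBpos
  have ho := etaE_pos lam hlam η hη o
  have hp' := etaE_pos lam hlam η hη p
  have hr := rate_nonneg lam hlam μ hμ0 hμpos o n
  have hK0 : 0 ≤ K := (rate_nonneg lam hlam μ hμ0 hμpos o n).trans (hK o n)
  have hmain : rate lam μ o n * piX η μ n
      ≤ etaE lam η o / etaE lam η p * K * piX η μ (n - eV o + eV p) := by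
    by_cases h : rate lam μ o n = 0
    · rw [h, zero_mul]
      exact mul_nonneg (mul_nonneg (div_pos ho hp').le hK0) (hp _)
    · have e1 := rate_piX lam η μ hμpos o (n - eV o)
      rw [sub_add_eV lam μ hμ0 o n h] at e1
      have e2 := rate_piX lam η μ hμpos p (n - eV o)
      have e3 := mul_le_mul_of_nonneg_right (hK p (n - eV o + eV p)) (hp (n - eV o + eV p))
      rw [e2] at e3
      rw [e1, div_mul_eq_mul_div, div_mul_eq_mul_div, le_div_iff₀ hp']
      have := mul_le_mul_of_nonneg_left e3 ho.le
      linarith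
  have h1 : rate lam μ o n * a D * piX η μ n ≤ rate lam μ o n * piX η μ n := by
    have := mul_le_mul_of_nonneg_left (ha1 D) (mul_nonneg hr (hp n))
    linarith
  have h2 := mul_le_mul_of_nonneg_left (h1.trans hmain) (hY D).le
  simp only [piZ, phi]
  linarith

end Helpers

/-- spectral gap comparison under change of routing.  If
`R'^D − R^D` is positive semidefinite in `L²(ξ^D)` for every `D`, then
`Gap(Q^{Z'}) ≤ Gap(Q^Z)`. -/
theorem gap_comparison_routing
    (J : ℕ) (hJ : 1 ≤ J)
    (lam : ℝ) (hlam : 0 < lam)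
    (μ : Fin J → ℕ → ℝ)
    (hμ0 : ∀ j, μ j 0 = 0)
    (hμpos : ∀ j k, k ≠ 0 → 0 < μ j k)
    (hμbdd : ∃ M : ℝ, ∀ j k, μ j k ≤ M)
    (r : Finset (Fin J) → Option (Fin J) → Option (Fin J) → ℝ)
    (hrnn : ∀ D : Finset (Fin J), ∀ i ∈ ext J D, ∀ j ∈ ext J D, 0 ≤ r D i j)
    (hrsto : ∀ D : Finset (Fin J), ∀ i ∈ ext J D, ∑ j ∈ ext J D, r D i j = 1)
    (η : Fin J → ℝ) (hη : ∀ j, 0 < η j)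
    (htraffic : ∀ D : Finset (Fin J), ∀ j ∈ Dᶜ,
      η j = lam * r D none (some j) + ∑ i ∈ Dᶜ, η i * r D (some i) (some j))
    (r' : Finset (Fin J) → Option (Fin J) → Option (Fin J) → ℝ)
    (hrnn' : ∀ D : Finset (Fin J), ∀ i ∈ ext J D, ∀ j ∈ ext J D, 0 ≤ r' D i j)
    (hrsto' : ∀ D : Finset (Fin J), ∀ i ∈ ext J D, ∑ j ∈ ext J D, r' D i j = 1)
    (htraffic' : ∀ D : Finset (Fin J), ∀ j ∈ Dᶜ,
      η j = lam * r' D none (some j) + ∑ i ∈ Dᶜ, η i * r' D (some i) (some j))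
    (A B : Finset (Fin J) → ℝ)
    (hApos : ∀ D, 0 < A D) (hBpos : ∀ D, 0 < B D)
    (hA0 : A (∅ : Finset (Fin J)) = 1) (hB0 : B (∅ : Finset (Fin J)) = 1)
    (hC : ∀ j, Summable (fun k => prodK η μ j k))
    (hpsd : ∀ D : Finset (Fin J), ∀ u : Option (Fin J) → ℝ,
      0 ≤ ∑ j ∈ ext J D, xiV lam η D j * u j *
            ∑ i ∈ ext J D, (r' D j i - r D j i) * u i) :
    GapZ (piZ η μ A B) (QZ lam μ r' A B) ≤ GapZ (piZ η μ A B) (QZ lam μ r A B) := by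
  obtain ⟨M, hM⟩ := hμbdd
  have hK : ∀ (o : Option (Fin J)) n, rate lam μ o n ≤ max M lam := by
    intro o n
    cases o with
    | none => exact le_max_right _ _
    | some j => exact (hM j _).trans (le_max_left _ _)
  have hK0 : 0 ≤ max M lam := hlam.le.trans (le_max_right _ _)
  generalize max M lam = K at hK hK0
  have hπ : ∀ x, 0 ≤ piZ η μ A B x := fun x =>
    mul_nonneg (piY_nonneg' A B hApos hBpos _).le (piX_nonneg' η hη μ hμpos _)
  have hrate := rate_nonneg lam hlam μ hμ0 hμpos
  have heta := etaE_pos lam hlam η hη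
  have cc0 : ∀ s : Finset (Fin J) → Option (Fin J) → Option (Fin J) → ℝ,
      (∀ D : Finset (Fin J), ∀ i ∈ ext J D, ∀ j ∈ ext J D, 0 ≤ s D i j) →
      ∀ D o p, 0 ≤ cc s D o p := by
    intro s hs D o p
    unfold cc
    split_ifs with h
    · exact hs D o h.1 p h.2
    · exact le_rfl
  have cc1 : ∀ s : Finset (Fin J) → Option (Fin J) → Option (Fin J) → ℝ,
      (∀ D : Finset (Fin J), ∀ i ∈ ext J D, ∀ j ∈ ext J D, 0 ≤ s D i j) →
      (∀ D : Finset (Fin J), ∀ i ∈ ext J D, ∑ j ∈ ext J D, s D i j = 1) →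
      ∀ D o p, cc s D o p ≤ 1 := by
    intro s hs hs1 D o p
    unfold cc
    split_ifs with h
    · rw [← hs1 D o h.1]
      exact Finset.single_le_sum (fun j hj => hs D o h.1 j hj) h.2
    · exact zero_le_one
  have ccsum : ∀ s : Finset (Fin J) → Option (Fin J) → Option (Fin J) → ℝ,
      (∀ D : Finset (Fin J), ∀ i ∈ ext J D, ∑ j ∈ ext J D, s D i j = 1) →
      ∀ D o, ∑ p, cc s D o p = if o ∈ ext J D then 1 else 0 := by
    intro s hs1 D o
    unfold cc
    split_ifs with h
    · rw [← hs1 D o h]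
      simp [h]
    · simp [h]
  -- bounded below
  have hbdd : BddBelow {v : ℝ | ∃ f : Est J → ℝ,
      Summable (fun x => f x * f x * piZ η μ A B x) ∧ (∑' x, f x * piZ η μ A B x) = 0 ∧
      (∑' x, f x * f x * piZ η μ A B x) = 1 ∧
      v = ∑' x, f x * -(QZ lam μ r' A B f x) * piZ η μ A B x} := by
    have hq0 : ∀ D H, 0 ≤ qY0 A B D H := by
      intro D H
      unfold qY0
      split_ifs
      · exact (div_pos (hApos _) (hApos _)).le
      · exact (div_pos (hBpos _) (hBpos _)).le
      · exact le_rfl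
    have hb0 : ∀ D H (x : Est J), 0 ≤ bb A B D H x := by
      intro D H x
      unfold bb
      split_ifs
      · exact hq0 D H
      · exact le_rfl
    have hY := piY_nonneg' A B hApos hBpos
    refine ⟨-((∑ o, ∑ p, etaE lam η o / etaE lam η p * K) +
      ∑ D, ∑ H, qY0 A B D H * piY A B D / piY A B H), ?_⟩
    rintro v ⟨f, hf, -, hf1, rfl⟩
    have HJ : ∀ o p, _ := fun o p => genL (piZ η μ A B) f
      (fun x => rate lam μ o x.2 * cc r' x.1 o p) (phi o p) (etaE lam η o / etaE lam η p * K) hπ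
      (fun x => mul_nonneg (hrate _ _) (cc0 r' hrnn' _ _ _))
      (mul_nonneg (div_pos (heta _) (heta _)).le hK0)
      (jump_injOn lam μ hμ0 o p fun D => cc r' D o p)
      (jump_le lam hlam μ hμ0 hμpos K hK η hη A B hApos hBpos o p (fun D => cc r' D o p)
        (fun D => cc0 r' hrnn' _ _ _) (fun D => cc1 r' hrnn' hrsto' _ _ _)) hf
    have HB : ∀ D H, _ := fun D H => genL (piZ η μ A B) f
      (bb A B D H) (fun x => (H, x.2)) (qY0 A B D H * piY A B D / piY A B H) hπ
      (hb0 D H)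
      (div_nonneg (mul_nonneg (hq0 _ _) (hY _).le) (hY _).le)
      (by
        rintro ⟨D1, n⟩ hx ⟨D2, n'⟩ hy h
        have h1 : D1 = D := by
          by_contra hne
          exact hx (by simp [bb, hne])
        have h2 : D2 = D := by
          by_contra hne
          exact hy (by simp [bb, hne])
        simp only [Prod.mk.injEq, true_and] at h
        rw [h1, h2, h])
      (by
        rintro ⟨D1, n⟩
        have hX := piX_nonneg' η hη μ hμpos n
        simp only [piZ, bb]
        split_ifs with h
        · subst h
          have := (hY H).ne'
          apply le_of_eq
          field_simp
        · rw [zero_mul]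
          exact mul_nonneg (div_nonneg (mul_nonneg (hq0 _ _) (hY _).le) (hY _).le)
            (mul_nonneg (hY _).le hX)) hf
    rw [hf1] at HJ HB
    simp only [mul_one] at HJ HB
    have hsJ : HasSum (fun x => ∑ o, ∑ p, rate lam μ o x.2 * cc r' x.1 o p *
        (f (phi o p x) * f (phi o p x)) * piZ η μ A B x) _ :=
      hasSum_sum fun o _ => hasSum_sum fun p _ => (HJ o p).1.hasSum
    have hsB : HasSum (fun x : Est J => ∑ D, ∑ H, bb A B D H x *
        (f (H, x.2) * f (H, x.2)) * piZ η μ A B x) _ :=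
      hasSum_sum fun D _ => hasSum_sum fun H _ => (HB D H).1.hasSum
    have hs := hsJ.add hsB
    have hle2 := add_le_add
      (Finset.sum_le_sum fun o (_ : o ∈ Finset.univ) =>
        Finset.sum_le_sum fun p (_ : p ∈ Finset.univ) => (HJ o p).2)
      (Finset.sum_le_sum fun D (_ : D ∈ Finset.univ) =>
        Finset.sum_le_sum fun H (_ : H ∈ Finset.univ) => (HB D H).2)
    refine le_trans (neg_le_neg hle2) ?_
    rw [← hs.tsum_eq, ← tsum_neg]
    have hel : ∀ (w u v p : ℝ), 0 ≤ w → 0 ≤ p → u * (w * (v - u)) * p ≤ w * (v * v) * p := by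
      intro w u v p hw hp
      have : u * (v - u) ≤ v * v := by nlinarith [sq_nonneg (u - v), sq_nonneg u, sq_nonneg v]
      have := mul_le_mul_of_nonneg_left this (mul_nonneg hw hp)
      linarith
    by_cases hsum : Summable fun x => f x * -(QZ lam μ r' A B f x) * piZ η μ A B x
    · refine hs.summable.neg.tsum_le_tsum (fun x => ?_) hsum
      rw [mul_neg, neg_mul, QZ_eq]
      apply neg_le_neg
      rw [mul_add, add_mul]
      refine add_le_add ?_ ?_
      · simp only [Finset.mul_sum, Finset.sum_mul]
        refine Finset.sum_le_sum fun o _ => Finset.sum_le_sum fun p _ => ?_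
        exact hel _ _ _ _ (mul_nonneg (hrate _ _) (cc0 r' hrnn' _ _ _)) (hπ x)
      · simp only [Finset.mul_sum, Finset.sum_mul]
        refine Finset.sum_le_sum fun o _ => Finset.sum_le_sum fun p _ => ?_
        exact hel _ _ _ _ (hb0 _ _ _) (hπ x)
    · rw [tsum_eq_zero_of_not_summable hsum]
      refine tsum_nonpos fun x => neg_nonpos.mpr (add_nonneg ?_ ?_)
      · refine Finset.sum_nonneg fun o _ => Finset.sum_nonneg fun p _ => ?_
        exact mul_nonneg (mul_nonneg (mul_nonneg (hrate _ _) (cc0 r' hrnn' _ _ _))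
          (mul_self_nonneg _)) (hπ x)
      · refine Finset.sum_nonneg fun o _ => Finset.sum_nonneg fun p _ => ?_
        exact mul_nonneg (mul_nonneg (hb0 _ _ _) (mul_self_nonneg _)) (hπ x)
  -- the comparison of Dirichlet forms
  have hcmp : ∀ f : Est J → ℝ, Summable (fun x => f x * f x * piZ η μ A B x) →
      ∑' x, f x * -(QZ lam μ r' A B f x) * piZ η μ A B x
        ≤ ∑' x, f x * -(QZ lam μ r A B f x) * piZ η μ A B x := by
    intro f hf
    have HS : ∀ s : Finset (Fin J) → Option (Fin J) → Option (Fin J) → ℝ,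
      (∀ D : Finset (Fin J), ∀ i ∈ ext J D, ∀ j ∈ ext J D, 0 ≤ s D i j) →
      (∀ D : Finset (Fin J), ∀ i ∈ ext J D, ∑ j ∈ ext J D, s D i j = 1) →
      ∀ o p, Summable fun x : Est J => rate lam μ o x.2 * cc s x.1 o p * (f x * f (phi o p x))
        * piZ η μ A B x := by
      intro s hs hs1 o p
      exact genS (piZ η μ A B) f
        (fun x => rate lam μ o x.2 * cc s x.1 o p) (phi o p) (etaE lam η o / etaE lam η p * K) K hπ
        (fun x => mul_nonneg (hrate _ _) (cc0 s hs _ _ _))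
        (mul_nonneg (div_pos (heta _) (heta _)).le hK0)
        (jump_injOn lam μ hμ0 o p fun D => cc s D o p)
        (jump_le lam hlam μ hμ0 hμpos K hK η hη A B hApos hBpos o p (fun D => cc s D o p)
          (fun D => cc0 s hs _ _ _) (fun D => cc1 s hs hs1 _ _ _))
        (fun x => (mul_le_of_le_one_right (hrate _ _) (cc1 s hs hs1 _ _ _)).trans (hK _ _)) hf
    set G : Option (Fin J) → Option (Fin J) → Est J → ℝ := fun o p x =>
      rate lam μ o x.2 * (cc r' x.1 o p - cc r x.1 o p) * (f x * f (phi o p x))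
        * piZ η μ A B x with hG
    have hGs : ∀ o p, Summable (G o p) := by
      intro o p
      refine ((HS r' hrnn' hrsto' o p).sub (HS r hrnn hrsto o p)).congr fun x => ?_
      simp only [hG]; ring
    have hinj : ∀ o : Option (Fin J), Function.Injective
        (fun x : Est J => ((x.1, x.2 + eV o) : Est J)) := by
      rintro o ⟨D, n⟩ ⟨D', n'⟩ h
      simp only [Prod.mk.injEq, add_left_inj] at h
      rw [h.1, h.2]
    have hrange : ∀ o p, ∀ x ∉ Set.range (fun x : Est J => ((x.1, x.2 + eV o) : Est J)),
        G o p x = 0 := by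
      intro o p x hx
      have : rate lam μ o x.2 = 0 := by
        by_contra h
        exact hx ⟨(x.1, x.2 - eV o), by simp [sub_add_eV lam μ hμ0 o x.2 h]⟩
      simp [hG, this]
    set H : Option (Fin J) → Option (Fin J) → Est J → ℝ := fun o p x =>
      etaE lam η o * (cc r' x.1 o p - cc r x.1 o p) *
        (f (x.1, x.2 + eV o) * f (x.1, x.2 + eV p)) * piZ η μ A B x with hH
    have hGH : ∀ o p (x : Est J), G o p (x.1, x.2 + eV o) = H o p x := by
      intro o p x
      have := rate_piX lam η μ hμpos o x.2
      simp only [hG, hH, phi, piZ, add_tsub_cancel_right]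
      linear_combination (cc r' x.1 o p - cc r x.1 o p) *
        (f (x.1, x.2 + eV o) * f (x.1, x.2 + eV p)) * piY A B x.1 * this
    have hHsum : ∀ o p, HasSum (H o p) (∑' x, G o p x) := by
      intro o p
      have := (hinj o).hasSum_iff (hrange o p) |>.mpr (hGs o p).hasSum
      convert this using 1
      funext x
      exact (hGH o p x).symm
    have hpos : 0 ≤ ∑ o, ∑ p, ∑' x, G o p x := by
      have h1 : HasSum (fun x => ∑ o, ∑ p, H o p x) (∑ o, ∑ p, ∑' x, G o p x) :=
        hasSum_sum fun o _ => hasSum_sum fun p _ => hHsum o p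
      refine h1.nonneg fun x => ?_
      have h2 := hpsd x.1 (fun o => f (x.1, x.2 + eV o))
      have hT : 0 < ∑ k ∈ ext J x.1, etaE lam η k :=
        Finset.sum_pos (fun k _ => heta k) ⟨none, none_mem_ext _⟩
      have h3 : ∑ o, ∑ p, H o p x = piZ η μ A B x * (∑ k ∈ ext J x.1, etaE lam η k) *
          ∑ j ∈ ext J x.1, xiV lam η x.1 j * f (x.1, x.2 + eV j) *
            ∑ i ∈ ext J x.1, (r' x.1 j i - r x.1 j i) * f (x.1, x.2 + eV i) := by
        simp only [xiV]
        generalize (∑ k ∈ ext J x.1, etaE lam η k) = T at hT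
        rw [Finset.mul_sum]
        rw [← Finset.sum_subset (Finset.subset_univ (ext J x.1))]
        · refine Finset.sum_congr rfl fun o ho => ?_
          rw [← Finset.sum_subset (Finset.subset_univ (ext J x.1))]
          · rw [Finset.mul_sum, Finset.mul_sum]
            refine Finset.sum_congr rfl fun p hp => ?_
            simp only [hH, cc, ho, hp, and_self, if_true]
            field_simp
          · intro p _ hp
            simp [hH, cc, hp]
        · intro o _ ho
          refine Finset.sum_eq_zero fun p _ => ?_
          simp [hH, cc, ho]
      rw [h3]
      exact mul_nonneg (mul_nonneg (hπ x) hT.le) h2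
    have hdiff : HasSum (fun x => f x * -(QZ lam μ r A B f x) * piZ η μ A B x
        - f x * -(QZ lam μ r' A B f x) * piZ η μ A B x) (∑ o, ∑ p, ∑' x, G o p x) := by
      have h1 : HasSum (fun x => ∑ o, ∑ p, G o p x) (∑ o, ∑ p, ∑' x, G o p x) :=
        hasSum_sum fun o _ => hasSum_sum fun p _ => (hGs o p).hasSum
      convert h1 using 1
      funext x
      have hz : ∑ o, ∑ p, rate lam μ o x.2 * (cc r' x.1 o p - cc r x.1 o p) * (f x * f x)
          * piZ η μ A B x = 0 := by
        refine Finset.sum_eq_zero fun o _ => ?_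
        rw [← Finset.sum_mul, ← Finset.sum_mul, ← Finset.mul_sum, Finset.sum_sub_distrib,
          ccsum r' hrsto', ccsum r hrsto]
        simp
      rw [QZ_eq, QZ_eq]
      have hE : ∀ a b c p t : ℝ, t * -(a + c) * p - t * -(b + c) * p = (b - a) * (t * p) := by
        intros; ring
      rw [hE, ← sub_zero (∑ o, ∑ p, G o p x), ← hz, ← Finset.sum_sub_distrib,
        ← Finset.sum_sub_distrib, Finset.sum_mul]
      refine Finset.sum_congr rfl fun o _ => ?_
      rw [← Finset.sum_sub_distrib, ← Finset.sum_sub_distrib, Finset.sum_mul]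
      refine Finset.sum_congr rfl fun p _ => ?_
      simp only [hG]; ring
    by_cases h1 : Summable fun x => f x * -(QZ lam μ r A B f x) * piZ η μ A B x
    · have h2 : Summable fun x => f x * -(QZ lam μ r' A B f x) * piZ η μ A B x :=
        (h1.sub hdiff.summable).congr fun x => by simp only [sub_sub_cancel]
      have h3 := h1.tsum_sub h2
      rw [hdiff.tsum_eq] at h3
      linarith
    · have h2 : ¬ Summable fun x => f x * -(QZ lam μ r' A B f x) * piZ η μ A B x := fun h2 =>
        h1 ((h2.add hdiff.summable).congr fun x => by ring)
      rw [tsum_eq_zero_of_not_summable h1, tsum_eq_zero_of_not_summable h2]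
  unfold GapZ
  by_cases hne : ∃ f : Est J → ℝ,
      Summable (fun x => f x * f x * piZ η μ A B x) ∧ (∑' x, f x * piZ η μ A B x) = 0 ∧
      (∑' x, f x * f x * piZ η μ A B x) = 1
  · obtain ⟨f, h1, h2, h3⟩ := hne
    refine le_csInf ⟨_, f, h1, h2, h3, rfl⟩ ?_
    rintro v ⟨g, g1, g2, g3, rfl⟩
    exact (csInf_le hbdd ⟨g, g1, g2, g3, rfl⟩).trans (hcmp g g1)
  · apply le_of_eq
    congr 1
    ext v
    constructor
    · rintro ⟨f, h1, h2, h3, -⟩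
      exact absurd ⟨f, h1, h2, h3⟩ hne
    · rintro ⟨f, h1, h2, h3, -⟩
      exact absurd ⟨f, h1, h2, h3⟩ hne


end UnrelNet
end
end

section
/- Peskun order implies positive semidefinite order for generators: let E be a finite set, let Q = (q(x,y)) and Q′ = (q′(x,y)) be generator matrices on E, and let π̂ be a probability vector on E with π̂Q = π̂Q′ = 0. If q(x,y) ≤ q′(x,y) for all x ≠ y, then the matrix Q − Q′ is positive semidefinite in L²(π̂): for every f : E → ℝ, Σ_{x∈E} π̂(x) f(x)·Σ_{y∈E} (q(x,y) − q′(x,y)) f(y) ≥ 0. -/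
open scoped BigOperators

noncomputable section

namespace UnrelNet

/-- Peskun order implies positive semidefinite order for
generator matrices with a common stationary probability vector. -/
theorem peskun_implies_pd_generators
    (E : Type) [Fintype E]
    (q q' : E → E → ℝ)
    (hqnn : ∀ x y, x ≠ y → 0 ≤ q x y) (hqrow : ∀ x, ∑ y, q x y = 0)
    (hq'nn : ∀ x y, x ≠ y → 0 ≤ q' x y) (hq'row : ∀ x, ∑ y, q' x y = 0)
    (pihat : E → ℝ) (hπnn : ∀ x, 0 ≤ pihat x) (hπ1 : ∑ x, pihat x = 1)
    (hstat : ∀ y, ∑ x, pihat x * q x y = 0)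
    (hstat' : ∀ y, ∑ x, pihat x * q' x y = 0)
    (hpeskun : ∀ x y, x ≠ y → q x y ≤ q' x y) :
    ∀ f : E → ℝ, 0 ≤ ∑ x, pihat x * f x * ∑ y, (q x y - q' x y) * f y := by
  intro f
  have h1 : ∑ x, ∑ y, pihat x * (q x y - q' x y) * f x ^ 2 = 0 := by
    apply Finset.sum_eq_zero
    intro x _
    have : ∑ y, (q x y - q' x y) = 0 := by
      rw [Finset.sum_sub_distrib, hqrow, hq'row, sub_zero]
    rw [← Finset.sum_mul, ← Finset.mul_sum, this]
    ring
  have h2 : ∑ x, ∑ y, pihat x * (q x y - q' x y) * f y ^ 2 = 0 := by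
    rw [Finset.sum_comm]
    apply Finset.sum_eq_zero
    intro y _
    have : ∑ x, pihat x * (q x y - q' x y) = 0 := by
      simp only [mul_sub]
      rw [Finset.sum_sub_distrib, hstat, hstat', sub_zero]
    rw [← Finset.sum_mul, this, zero_mul]
  have h3 : 0 ≤ ∑ x, ∑ y, pihat x * (q' x y - q x y) * (f x - f y) ^ 2 := by
    apply Finset.sum_nonneg
    intro x _
    apply Finset.sum_nonneg
    intro y _
    by_cases h : x = y
    · subst h
      simp
    · exact mul_nonneg (mul_nonneg (hπnn x) (sub_nonneg.2 (hpeskun x y h))) (sq_nonneg _)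
  have h4 : ∑ x, ∑ y, pihat x * (q' x y - q x y) * (f x - f y) ^ 2
      = 2 * (∑ x, pihat x * f x * ∑ y, (q x y - q' x y) * f y)
        - ∑ x, ∑ y, pihat x * (q x y - q' x y) * f x ^ 2
        - ∑ x, ∑ y, pihat x * (q x y - q' x y) * f y ^ 2 := by
    simp only [Finset.mul_sum, ← Finset.sum_sub_distrib]
    refine Finset.sum_congr rfl fun x _ => Finset.sum_congr rfl fun y _ => ?_
    ring
  rw [h1, h2] at h4
  linarith

end UnrelNet
end
end

section
/- Peskun order implies positive semidefinite order for stochastic matrices: let E be a finite set, let P = (p(x,y)) and P′ = (p′(x,y)) be stochastic matrices on E, and let ξ be a probability vector on E with ξP = ξP′ = ξ. If p(x,y) ≤ p′(x,y) for all x ≠ y, then the matrix P − P′ is positive semidefinite in L²(ξ): for every f : E → ℝ, Σ_{x∈E} ξ(x) f(x)·Σ_{y∈E} (p(x,y) − p′(x,y)) f(y) ≥ 0. -/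
open scoped BigOperators

noncomputable section

namespace UnrelNet

/-- Peskun order implies positive semidefinite order for
stochastic matrices with a common stationary probability vector. -/
theorem peskun_implies_pd_stochastic
    (E : Type) [Fintype E]
    (p p' : E → E → ℝ)
    (hpnn : ∀ x y, 0 ≤ p x y) (hprow : ∀ x, ∑ y, p x y = 1)
    (hp'nn : ∀ x y, 0 ≤ p' x y) (hp'row : ∀ x, ∑ y, p' x y = 1)
    (ξ : E → ℝ) (hξnn : ∀ x, 0 ≤ ξ x) (hξ1 : ∑ x, ξ x = 1)
    (hstat : ∀ y, ∑ x, ξ x * p x y = ξ y)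
    (hstat' : ∀ y, ∑ x, ξ x * p' x y = ξ y)
    (hpeskun : ∀ x y, x ≠ y → p x y ≤ p' x y) :
    ∀ f : E → ℝ, 0 ≤ ∑ x, ξ x * f x * ∑ y, (p x y - p' x y) * f y := by
  intro f
  have h1 : ∑ x, ∑ y, ξ x * (p' x y - p x y) * f x ^ 2 = 0 := by
    apply Finset.sum_eq_zero
    intro x _
    rw [← Finset.sum_mul, ← Finset.mul_sum, Finset.sum_sub_distrib, hprow, hp'row]
    ring
  have h2 : ∑ x, ∑ y, ξ x * (p' x y - p x y) * f y ^ 2 = 0 := by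
    rw [Finset.sum_comm]
    apply Finset.sum_eq_zero
    intro y _
    rw [← Finset.sum_mul]
    simp only [mul_sub]
    rw [Finset.sum_sub_distrib, hstat, hstat']
    ring
  have h3 : 0 ≤ ∑ x, ∑ y, ξ x * (p' x y - p x y) * (f x - f y) ^ 2 := by
    refine Finset.sum_nonneg fun x _ => Finset.sum_nonneg fun y _ => ?_
    by_cases h : x = y
    · subst h
      simp
    · exact mul_nonneg (mul_nonneg (hξnn x) (sub_nonneg.2 (hpeskun x y h))) (sq_nonneg _)
  have h4 : ∑ x, ∑ y, ξ x * (p' x y - p x y) * (f x - f y) ^ 2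
      = ∑ x, ∑ y, ξ x * (p' x y - p x y) * f x ^ 2
        + ∑ x, ∑ y, ξ x * (p' x y - p x y) * f y ^ 2
        + 2 * ∑ x, ξ x * f x * ∑ y, (p x y - p' x y) * f y := by
    simp only [Finset.mul_sum, ← Finset.sum_add_distrib]
    refine Finset.sum_congr rfl fun x _ => Finset.sum_congr rfl fun y _ => ?_
    ring
  linarith

end UnrelNet
end
end

section
/- Scaled breakdown/repair rates: let A′, B′ : 2^{J̃} → (0,∞) with A′(∅) = B′(∅) = 1, let κ > 1, and define A(D) := κ^{|D|}A′(D) and B(D) := κ^{|D|}B′(D) for all D ⊆ J̃. Then (i) q^{Y′}(D,E) ≤ q^Y(D,E) for all distinct D, E ⊆ J̃, and (ii) the stationary distributions coincide: Ĉ^{−1}A(D)/B(D) = Ĉ′^{−1}A′(D)/B′(D) for all D; consequently Gap(Q^{Y′}) ≤ Gap(Q^Y). -/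
open scoped BigOperators

noncomputable section

namespace UnrelNet

theorem aux_diag {J : ℕ} (A B : Finset (Fin J) → ℝ) (D : Finset (Fin J)) : qY0 A B D D = 0 := by
  simp [qY0]

theorem aux_QYm {J : ℕ} (A B : Finset (Fin J) → ℝ) (f : Finset (Fin J) → ℝ)
    (D : Finset (Fin J)) : QYm A B f D = ∑ E, qY0 A B D E * (f E - f D) := by
  have h : ∀ E, qY A B D E * f E
      = qY0 A B D E * f E + (if E = D then -(∑ F, qY0 A B D F) * f D else 0) := by
    intro E
    unfold qY
    split_ifs with h
    · subst h
      rw [aux_diag]; ring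
    · ring
  unfold QYm
  rw [Finset.sum_congr rfl (fun E _ => h E), Finset.sum_add_distrib]
  simp only [Finset.sum_ite_eq', Finset.mem_univ, if_true, mul_sub, Finset.sum_sub_distrib,
    ← Finset.sum_mul]
  ring

theorem aux_db {J : ℕ} (A B : Finset (Fin J) → ℝ) (hA : ∀ D, 0 < A D) (hB : ∀ D, 0 < B D)
    (D E : Finset (Fin J)) : piY A B D * qY0 A B D E = piY A B E * qY0 A B E D := by
  have h1 := (hA D).ne'
  have h2 := (hA E).ne'
  have h3 := (hB D).ne'
  have h4 := (hB E).ne'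
  have hC : Chat A B ≠ 0 :=
    (Finset.sum_pos (fun D _ => div_pos (hA D) (hB D)) Finset.univ_nonempty).ne'
  unfold piY qY0
  by_cases h : D ⊂ E
  · have h' : ¬ E ⊂ D := fun g => (h.trans g).ne rfl
    rw [if_pos h, if_neg h', if_pos h]
    field_simp
  · by_cases h' : E ⊂ D
    · rw [if_neg h, if_pos h', if_pos h']
      field_simp
    · rw [if_neg h, if_neg h', if_neg h', if_neg h]
      simp

theorem aux_dir {J : ℕ} (A B : Finset (Fin J) → ℝ) (hA : ∀ D, 0 < A D) (hB : ∀ D, 0 < B D)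
    (f : Finset (Fin J) → ℝ) :
    -(∑ D, piY A B D * f D * QYm A B f D)
      = (∑ D, ∑ E, piY A B D * qY0 A B D E * (f E - f D) ^ 2) / 2 := by
  have e1 : ∑ D, piY A B D * f D * QYm A B f D
      = ∑ D, ∑ E, piY A B D * qY0 A B D E * (f D * (f E - f D)) := by
    refine Finset.sum_congr rfl fun D _ => ?_
    rw [aux_QYm, Finset.mul_sum]
    exact Finset.sum_congr rfl fun E _ => by ring
  have e2 : ∑ D, piY A B D * f D * QYm A B f D
      = ∑ D, ∑ E, piY A B D * qY0 A B D E * (f E * (f D - f E)) := by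
    rw [e1, Finset.sum_comm]
    refine Finset.sum_congr rfl fun D _ => Finset.sum_congr rfl fun E _ => ?_
    rw [aux_db A B hA hB]
  have e3 : ∑ D, ∑ E, piY A B D * qY0 A B D E * (f E - f D) ^ 2
      = -(∑ D, ∑ E, piY A B D * qY0 A B D E * (f D * (f E - f D)))
        - ∑ D, ∑ E, piY A B D * qY0 A B D E * (f E * (f D - f E)) := by
    simp only [← Finset.sum_neg_distrib, ← Finset.sum_sub_distrib]
    exact Finset.sum_congr rfl fun D _ => Finset.sum_congr rfl fun E _ => by ring
  rw [e3, ← e1, ← e2]; ring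

/-- scaled breakdown/repair rates `A(D) = κ^{|D|}A'(D)`,
`B(D) = κ^{|D|}B'(D)` with `κ > 1`: (i) Peskun comparison of the rates,
(ii) equal stationary distributions; consequently `Gap(Q^{Y'}) ≤ Gap(Q^Y)`. -/
theorem gap_comparison_scaled_rates
    (J : ℕ) (hJ : 1 ≤ J)
    (A' B' : Finset (Fin J) → ℝ)
    (hA'pos : ∀ D, 0 < A' D) (hB'pos : ∀ D, 0 < B' D)
    (hA'0 : A' (∅ : Finset (Fin J)) = 1) (hB'0 : B' (∅ : Finset (Fin J)) = 1)
    (κ : ℝ) (hκ : 1 < κ)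
    (A B : Finset (Fin J) → ℝ)
    (hA : ∀ D : Finset (Fin J), A D = κ ^ D.card * A' D)
    (hB : ∀ D : Finset (Fin J), B D = κ ^ D.card * B' D) :
    (∀ D E : Finset (Fin J), D ≠ E → qY A' B' D E ≤ qY A B D E)
      ∧ (∀ D : Finset (Fin J), piY A B D = piY A' B' D)
      ∧ GapY (piY A' B') (QYm A' B') ≤ GapY (piY A' B') (QYm A B) := by
  have hκ0 : 0 < κ := by linarith
  have hApos : ∀ D, 0 < A D := fun D => by rw [hA]; exact mul_pos (pow_pos hκ0 _) (hA'pos D)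
  have hBpos : ∀ D, 0 < B D := fun D => by rw [hB]; exact mul_pos (pow_pos hκ0 _) (hB'pos D)
  have key : ∀ (a' : Finset (Fin J) → ℝ) (_ : ∀ D, 0 < a' D) (D E : Finset (Fin J)), D ⊂ E →
      a' E / a' D ≤ (κ ^ E.card * a' E) / (κ ^ D.card * a' D) := by
    intro a' ha D E h
    rw [mul_div_mul_comm]
    refine le_mul_of_one_le_left (div_pos (ha E) (ha D)).le ?_
    rw [one_le_div (pow_pos hκ0 _)]
    exact pow_le_pow_right₀ hκ.le (Finset.card_le_card h.subset)
  have hq0 : ∀ D E, qY0 A' B' D E ≤ qY0 A B D E := by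
    intro D E
    unfold qY0
    split_ifs with h h'
    · rw [hA, hA]; exact key A' hA'pos D E h
    · rw [hB, hB]; exact key B' hB'pos E D h'
    · exact le_rfl
  have hq0' : ∀ D E, 0 ≤ qY0 A' B' D E := by
    intro D E
    unfold qY0
    split_ifs
    · exact (div_pos (hA'pos _) (hA'pos _)).le
    · exact (div_pos (hB'pos _) (hB'pos _)).le
    · exact le_rfl
  have hr : ∀ D, A D / B D = A' D / B' D := fun D => by
    rw [hA, hB, mul_div_mul_left _ _ (pow_pos hκ0 _).ne']
  have hpi : ∀ D, piY A B D = piY A' B' D := by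
    intro D
    simp only [piY, Chat, hr]
  have hpos : ∀ D, 0 ≤ piY A' B' D := fun D =>
    div_nonneg (div_pos (hA'pos D) (hB'pos D)).le
      (Finset.sum_nonneg fun D _ => (div_pos (hA'pos D) (hB'pos D)).le)
  refine ⟨?_, hpi, ?_⟩
  · intro D E h
    unfold qY
    rw [if_neg h.symm, if_neg h.symm]
    exact hq0 D E
  · have hpf : piY A B = piY A' B' := funext hpi
    have d := aux_dir A B hApos hBpos
    rw [hpf] at d
    have d' := aux_dir A' B' hA'pos hB'pos
    unfold GapY
    by_cases hne : ∃ f : Finset (Fin J) → ℝ,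
        (∑ D, piY A' B' D * f D) = 0 ∧ (∑ D, piY A' B' D * f D ^ 2) = 1
    · obtain ⟨f0, h1, h2⟩ := hne
      refine le_csInf ⟨_, f0, h1, h2, rfl⟩ ?_
      rintro v ⟨f, hf1, hf2, rfl⟩
      refine le_trans (csInf_le ⟨0, ?_⟩ ⟨f, hf1, hf2, rfl⟩) ?_
      · rintro v ⟨g, _, _, rfl⟩
        rw [d']
        exact div_nonneg (Finset.sum_nonneg fun D _ => Finset.sum_nonneg fun E _ =>
          mul_nonneg (mul_nonneg (hpos D) (hq0' D E)) (sq_nonneg _)) (by norm_num)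
      · rw [d, d']
        refine div_le_div_of_nonneg_right ?_ (by norm_num)
        exact Finset.sum_le_sum fun D _ => Finset.sum_le_sum fun E _ =>
          mul_le_mul_of_nonneg_right (mul_le_mul_of_nonneg_left (hq0 D E) (hpos D)) (sq_nonneg _)
    · refine le_of_eq (congrArg sInf ?_)
      ext v
      constructor
      · rintro ⟨f, h1, h2, _⟩
        exact absurd ⟨f, h1, h2⟩ hne
      · rintro ⟨f, h1, h2, _⟩
        exact absurd ⟨f, h1, h2⟩ hne

end UnrelNet
end
end

section
/- Feedback comparison routing: fix D ⊆ J̃ and assume the overall balance condition η_j·Σ_{i∈J̃∖D} r^D_{ji} = Σ_{i∈J̃∖D} η_i r^D_{ij} for all j ∈ J̃∖D. Define the matrix R′^D on J̃₀∖D by r′^D_{00} = r^D_{00}, r′^D_{0i} = r^D_{0i} and r′^D_{i0} = r^D_{i0} for i ∈ J̃∖D, r′^D_{ii} = 1 − r^D_{i0} for i ∈ J̃∖D, and r′^D_{ij} = 0 for distinct i, j ∈ J̃∖D. Then (a) R′^D is a stochastic matrix; (b) η_j = λ r′^D_{0j} + Σ_{i∈J̃∖D} η_i r′^D_{ij} for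 all j ∈ J̃∖D (equivalently η_j = λ r^D_{0j} + η_j(1 − r^D_{j0})), i.e. η restricted to J̃∖D solves the D-traffic equations for R′^D; and (c) R′^D ≺_P R^D, i.e. r′^D_{ij} ≤ r^D_{ij} for all distinct i, j ∈ J̃₀∖D. -/
open scoped BigOperators

noncomputable section

namespace UnrelNet

/-- feedback comparison routing.  Under the overall balance
condition, the pure birth/death-with-feedback matrix `R'^D` is stochastic,
keeps `η` as a solution of the `D`-traffic equations, and is Peskun-below
`R^D`. -/
theorem feedback_routing
    (J : ℕ) (hJ : 1 ≤ J)
    (lam : ℝ) (hlam : 0 < lam)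
    (D : Finset (Fin J))
    (rD : Option (Fin J) → Option (Fin J) → ℝ)
    (hrnn : ∀ i ∈ ext J D, ∀ j ∈ ext J D, 0 ≤ rD i j)
    (hrsto : ∀ i ∈ ext J D, ∑ j ∈ ext J D, rD i j = 1)
    (η : Fin J → ℝ) (hη : ∀ j, 0 < η j)
    (htraffic : ∀ j ∈ Dᶜ,
      η j = lam * rD none (some j) + ∑ i ∈ Dᶜ, η i * rD (some i) (some j))
    (hbal : ∀ j ∈ Dᶜ,
      η j * (∑ i ∈ Dᶜ, rD (some j) (some i)) = ∑ i ∈ Dᶜ, η i * rD (some i) (some j)) :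
    ∀ rD' : Option (Fin J) → Option (Fin J) → ℝ,
      rD' none none = rD none none →
      (∀ i ∈ Dᶜ, rD' none (some i) = rD none (some i)
        ∧ rD' (some i) none = rD (some i) none
        ∧ rD' (some i) (some i) = 1 - rD (some i) none) →
      (∀ i ∈ Dᶜ, ∀ j ∈ Dᶜ, i ≠ j → rD' (some i) (some j) = 0) →
      ((∀ i ∈ ext J D, ∀ j ∈ ext J D, 0 ≤ rD' i j)
          ∧ (∀ i ∈ ext J D, ∑ j ∈ ext J D, rD' i j = 1))
        ∧ ((∀ j ∈ Dᶜ,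
            η j = lam * rD' none (some j) + ∑ i ∈ Dᶜ, η i * rD' (some i) (some j))
          ∧ (∀ j ∈ Dᶜ, η j = lam * rD none (some j) + η j * (1 - rD (some j) none)))
        ∧ (∀ i ∈ ext J D, ∀ j ∈ ext J D, i ≠ j → rD' i j ≤ rD i j) := by
  intro rD' h00 h1 h2
  have hsum : ∀ f : Option (Fin J) → ℝ, ∑ j ∈ ext J D, f j = f none + ∑ j ∈ Dᶜ, f (some j) := by
    intro f
    unfold ext
    rw [Finset.sum_insert (by simp), Finset.sum_image (by simp)]
  have hn : none ∈ ext J D := by simp [ext]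
  have hs : ∀ j, some j ∈ ext J D ↔ j ∈ Dᶜ := by intro j; simp [ext]
  have hrow : ∀ j ∈ Dᶜ, ∑ i ∈ Dᶜ, rD (some j) (some i) = 1 - rD (some j) none := by
    intro j hj
    have := hrsto (some j) ((hs j).2 hj)
    rw [hsum] at this
    linarith
  have hle : ∀ j ∈ Dᶜ, 0 ≤ 1 - rD (some j) none := by
    intro j hj
    rw [← hrow j hj]
    exact Finset.sum_nonneg fun i hi => hrnn _ ((hs j).2 hj) _ ((hs i).2 hi)
  have hb : ∀ j ∈ Dᶜ, η j = lam * rD none (some j) + η j * (1 - rD (some j) none) := by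
    intro j hj
    rw [← hrow j hj, hbal j hj]
    exact htraffic j hj
  refine ⟨⟨?_, ?_⟩, ⟨?_, hb⟩, ?_⟩
  · rintro (_ | i) hi (_ | j) hj
    · rw [h00]; exact hrnn _ hi _ hj
    · rw [(h1 j ((hs j).1 hj)).1]; exact hrnn _ hi _ hj
    · rw [(h1 i ((hs i).1 hi)).2.1]; exact hrnn _ hi _ hj
    · by_cases hij : i = j
      · subst hij
        rw [(h1 i ((hs i).1 hi)).2.2]; exact hle i ((hs i).1 hi)
      · rw [h2 i ((hs i).1 hi) j ((hs j).1 hj) hij]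
  · rintro (_ | i) hi
    · rw [← hrsto none hi, hsum, hsum, h00]
      congr 1
      exact Finset.sum_congr rfl fun j hj => (h1 j hj).1
    · have hi' := (hs i).1 hi
      rw [hsum, Finset.sum_eq_single_of_mem i hi' (fun j hj hji => h2 i hi' j hj (Ne.symm hji)),
        (h1 i hi').2.1, (h1 i hi').2.2]
      ring
  · intro j hj
    rw [Finset.sum_eq_single_of_mem j hj (fun i hi hij => by rw [h2 i hi j hj hij, mul_zero]),
      (h1 j hj).1, (h1 j hj).2.2]
    exact hb j hj
  · rintro (_ | i) hi (_ | j) hj hij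
    · exact absurd rfl hij
    · rw [(h1 j ((hs j).1 hj)).1]
    · rw [(h1 i ((hs i).1 hi)).2.1]
    · rw [h2 i ((hs i).1 hi) j ((hs j).1 hj) (fun h => hij (by rw [h]))]
      exact hrnn _ hi _ hj

end UnrelNet
end
end

section
/- Reversible routing yields a reversible network: assume that for every D ⊆ J̃ the routing matrix R^D is reversible with respect to η^D, i.e. η^D_i r^D_{ij} = η^D_j r^D_{ji} for all i, j ∈ J̃₀∖D, where η^D_0 := λ and η^D_j := η_j for j ∈ J̃∖D. Then the unreliable Jackson network satisfies detailed balance with respect to π̃: for all distinct states x, y ∈ Ẽ, π̃(x)·q^Z(x,y) = π̃(y)·q^Z(y,x). -/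
open scoped BigOperators

noncomputable section

namespace UnrelNet

theorem eV_self {J : ℕ} (j : Fin J) : eV (some j) j = 1 := by simp [eV]

theorem prodK_succ {J : ℕ} (η : Fin J → ℝ) (μ : Fin J → ℕ → ℝ) (j : Fin J) (k : ℕ) :
    prodK η μ j (k + 1) = prodK η μ j k * (η j / μ j (k + 1)) := by
  simp only [prodK, Finset.prod_range_succ]

theorem piX_add {J : ℕ} (η : Fin J → ℝ) (μ : Fin J → ℕ → ℝ)
    (hμpos : ∀ j k, k ≠ 0 → 0 < μ j k) (n : Fin J → ℕ) (j : Fin J) :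
    piX η μ (n + eV (some j)) * μ j ((n + eV (some j)) j) = piX η μ n * η j := by
  have h1 : (n + eV (some j)) j = n j + 1 := by simp [eV]
  have hne : μ j (n j + 1) ≠ 0 := (hμpos j _ (Nat.succ_ne_zero _)).ne'
  unfold piX
  rw [← Finset.mul_prod_erase Finset.univ _ (Finset.mem_univ j),
    ← Finset.mul_prod_erase Finset.univ (fun i => prodK η μ i (n i) / Cnorm η μ i)
      (Finset.mem_univ j)]
  have h2 : ∏ i ∈ Finset.univ.erase j, prodK η μ i ((n + eV (some j)) i) / Cnorm η μ i
      = ∏ i ∈ Finset.univ.erase j, prodK η μ i (n i) / Cnorm η μ i := by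
    refine Finset.prod_congr rfl fun i hi => ?_
    have : (n + eV (some j)) i = n i := by simp [eV, Finset.ne_of_mem_erase hi]
    rw [this]
  rw [h2, h1, prodK_succ]
  set P := ∏ i ∈ Finset.univ.erase j, prodK η μ i (n i) / Cnorm η μ i
  have h3 : η j / μ j (n j + 1) * μ j (n j + 1) = η j := div_mul_cancel₀ _ hne
  calc _ = prodK η μ j (n j) / Cnorm η μ j * P * (η j / μ j (n j + 1) * μ j (n j + 1)) := by
        ring
    _ = _ := by rw [h3]

theorem move_balance {J : ℕ} (lam : ℝ) (μ : Fin J → ℕ → ℝ)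
    (hμpos : ∀ j k, k ≠ 0 → 0 < μ j k) (r : Option (Fin J) → Option (Fin J) → ℝ)
    (η : Fin J → ℝ) (D : Finset (Fin J))
    (hrev : ∀ i ∈ ext J D, ∀ j ∈ ext J D, etaE lam η i * r i j = etaE lam η j * r j i)
    (n m : Fin J → ℕ) :
    piX η μ n * (∑ j ∈ Dᶜ,
          ((if m = n + eV (some j) then lam * r none (some j) else 0)
            + (if m + eV (some j) = n then μ j (n j) * r (some j) none else 0)
            + ∑ i ∈ Dᶜ,
                if i ≠ j ∧ m + eV (some j) = n + eV (some i) then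
                  μ j (n j) * r (some j) (some i)
                else 0)) =
    piX η μ m * (∑ j ∈ Dᶜ,
          ((if n = m + eV (some j) then lam * r none (some j) else 0)
            + (if n + eV (some j) = m then μ j (m j) * r (some j) none else 0)
            + ∑ i ∈ Dᶜ,
                if i ≠ j ∧ n + eV (some j) = m + eV (some i) then
                  μ j (m j) * r (some j) (some i)
                else 0)) := by
  have hn : (none : Option (Fin J)) ∈ ext J D := by simp [ext]
  have hs : ∀ j ∈ Dᶜ, some j ∈ ext J D := by
    intro j hj
    simpa [ext] using hj
  have hab : ∀ n m : Fin J → ℕ, ∀ j ∈ Dᶜ,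
      piX η μ n * (if m = n + eV (some j) then lam * r none (some j) else 0)
      = piX η μ m * (if n + eV (some j) = m then μ j (m j) * r (some j) none else 0) := by
    intro n m j hj
    by_cases h : m = n + eV (some j)
    · subst h
      have h1 := piX_add η μ hμpos n j
      have h2 : lam * r none (some j) = η j * r (some j) none := hrev _ hn _ (hs j hj)
      rw [if_pos rfl, if_pos rfl, h2, ← mul_assoc, ← mul_assoc, h1]
    · rw [if_neg h, if_neg (fun h' => h h'.symm)]
      simp
  have hc : ∀ j ∈ Dᶜ, ∀ i ∈ Dᶜ,
      piX η μ n * (if i ≠ j ∧ m + eV (some j) = n + eV (some i) then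
                  μ j (n j) * r (some j) (some i) else 0)
      = piX η μ m * (if j ≠ i ∧ n + eV (some i) = m + eV (some j) then
                  μ i (m i) * r (some i) (some j) else 0) := by
    intro j hj i hi
    by_cases h : i ≠ j ∧ m + eV (some j) = n + eV (some i)
    · rw [if_pos h, if_pos ⟨h.1.symm, h.2.symm⟩]
      obtain ⟨hij, h⟩ := h
      have hn1 : n j = m j + 1 := by
        have := congrFun h j
        simp [eV, hij.symm] at this
        omega
      obtain ⟨k, hk⟩ : ∃ k : Fin J → ℕ, n = k + eV (some j) := by
        refine ⟨n - eV (some j), ?_⟩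
        funext l
        by_cases hl : l = j
        · subst hl
          simp [eV]
          omega
        · simp [eV, hl]
      have hm : m = k + eV (some i) := by
        funext l
        have := congrFun h l
        rw [hk] at this
        simp only [Pi.add_apply] at this ⊢
        omega
      have h2 : η j * r (some j) (some i) = η i * r (some i) (some j) :=
        hrev _ (hs j hj) _ (hs i hi)
      rw [hk, hm, ← mul_assoc, ← mul_assoc, piX_add η μ hμpos, piX_add η μ hμpos,
        mul_assoc, mul_assoc, h2]
    · rw [if_neg h, if_neg (fun h' => h ⟨h'.1.symm, h'.2.symm⟩)]
      simp
  simp only [Finset.sum_add_distrib, mul_add]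
  have e1 := Finset.sum_congr (rfl : Dᶜ = Dᶜ) (hab n m)
  have e2 := Finset.sum_congr (rfl : Dᶜ = Dᶜ) (hab m n)
  have e3 := Finset.sum_congr (rfl : Dᶜ = Dᶜ)
    (fun j hj => Finset.sum_congr (rfl : Dᶜ = Dᶜ) (hc j hj))
  rw [Finset.sum_comm (f := fun j i => piX η μ m * _)] at e3
  simp only [← Finset.mul_sum] at e1 e2 e3
  rw [e1, e3, e2]
  ring

/-- reversible routing yields a reversible network: if every
`R^D` is reversible with respect to `η^D`, then the unreliable Jackson network
satisfies detailed balance with respect to `π̃`. -/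
theorem reversible_routing_reversible_network
    (J : ℕ) (hJ : 1 ≤ J)
    (lam : ℝ) (hlam : 0 < lam)
    (μ : Fin J → ℕ → ℝ)
    (hμ0 : ∀ j, μ j 0 = 0)
    (hμpos : ∀ j k, k ≠ 0 → 0 < μ j k)
    (hμbdd : ∃ M : ℝ, ∀ j k, μ j k ≤ M)
    (r : Finset (Fin J) → Option (Fin J) → Option (Fin J) → ℝ)
    (hrnn : ∀ D : Finset (Fin J), ∀ i ∈ ext J D, ∀ j ∈ ext J D, 0 ≤ r D i j)
    (hrsto : ∀ D : Finset (Fin J), ∀ i ∈ ext J D, ∑ j ∈ ext J D, r D i j = 1)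
    (η : Fin J → ℝ) (hη : ∀ j, 0 < η j)
    (htraffic : ∀ D : Finset (Fin J), ∀ j ∈ Dᶜ,
      η j = lam * r D none (some j) + ∑ i ∈ Dᶜ, η i * r D (some i) (some j))
    (A B : Finset (Fin J) → ℝ)
    (hApos : ∀ D, 0 < A D) (hBpos : ∀ D, 0 < B D)
    (hA0 : A (∅ : Finset (Fin J)) = 1) (hB0 : B (∅ : Finset (Fin J)) = 1)
    (hC : ∀ j, Summable (fun k => prodK η μ j k))
    (hrev : ∀ D : Finset (Fin J), ∀ i ∈ ext J D, ∀ j ∈ ext J D,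
      etaE lam η i * r D i j = etaE lam η j * r D j i) :
    ∀ x y : Est J, x ≠ y →
      piZ η μ A B x * qZ lam μ r A B x y = piZ η μ A B y * qZ lam μ r A B y x := by
  intro x y hxy
  obtain ⟨D, n⟩ := x
  obtain ⟨E, m⟩ := y
  unfold qZ piZ
  rw [if_neg hxy, if_neg hxy.symm]
  dsimp only
  by_cases hDE : E = D
  · subst hDE
    have hnm : m ≠ n := fun h => hxy (by rw [h])
    rw [if_pos rfl, if_pos rfl, if_neg hnm, if_neg hnm.symm, add_zero, add_zero,
      mul_assoc, mul_assoc, move_balance lam μ hμpos (r E) η E (hrev E) n m]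
  · rw [if_neg hDE, if_neg (Ne.symm hDE), zero_add, zero_add]
    by_cases hnm : m = n
    · subst hnm
      rw [if_pos rfl, if_pos rfl]
      have a1 := (hApos D).ne'
      have a2 := (hApos E).ne'
      have b1 := (hBpos D).ne'
      have b2 := (hBpos E).ne'
      have k1 : A D / B D * (B D / B E) = A E / B E * (A D / A E) := by field_simp
      have k2 : A D / B D * (A E / A D) = A E / B E * (B E / B D) := by field_simp
      unfold piY
      by_cases h1 : E ⊂ D
      · have h2 : ¬ D ⊂ E := fun h => lt_asymm h h1
        rw [if_pos h1, if_neg h2, if_neg h2, if_pos h1]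
        linear_combination (piX η μ m / Chat A B) * k1
      · rw [if_neg h1, if_neg h1]
        by_cases h2 : D ⊂ E
        · rw [if_pos h2, if_pos h2]
          linear_combination (piX η μ m / Chat A B) * k2
        · rw [if_neg h2, if_neg h2]
          simp
    · rw [if_neg hnm, if_neg (Ne.symm hnm)]
      simp

end UnrelNet
end
end

section
/- Jackson's theorem (stationarity of the product form): the product measure π satisfies the global balance equations of the Jackson network: for every m ∈ ℕ^{J̃}, Σ_{n≠m} π(n)·q^X(n,m) = π(m)·Σ_{n≠m} q^X(m,n). -/
open scoped BigOperators

noncomputable section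

namespace UnrelNet

theorem aux_step {J : ℕ} (η : Fin J → ℝ) (μ : Fin J → ℕ → ℝ)
    (hμpos : ∀ j k, k ≠ 0 → 0 < μ j k) (n : Fin J → ℕ) (j : Fin J) :
    piX η μ (n + eV (some j)) * μ j (n j + 1) = η j * piX η μ n := by
  unfold piX
  rw [← Finset.mul_prod_erase _ _ (Finset.mem_univ j),
    ← Finset.mul_prod_erase Finset.univ (fun i => prodK η μ i (n i) / Cnorm η μ i)
      (Finset.mem_univ j)]
  have h1 : ∏ x ∈ Finset.univ.erase j, prodK η μ x ((n + eV (some j)) x) / Cnorm η μ x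
      = ∏ x ∈ Finset.univ.erase j, prodK η μ x (n x) / Cnorm η μ x := by
    apply Finset.prod_congr rfl
    intro x hx
    have : x ≠ j := Finset.ne_of_mem_erase hx
    simp [eV, this]
  rw [h1]
  have h2 : prodK η μ j ((n + eV (some j)) j) = prodK η μ j (n j) * (η j / μ j (n j + 1)) := by
    have e : (n + eV (some j)) j = n j + 1 := by simp [eV]
    rw [e]
    exact Finset.prod_range_succ _ _
  rw [h2]
  have h3 := (hμpos j (n j + 1) (by omega)).ne'
  field_simp

theorem aux_single {α : Type*} (P : α → Prop) [DecidablePred P] (f : α → ℝ) (a : α) (v : ℝ)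
    (h1 : ∀ n, P n → n = a) (h2 : P a → f a = v) (h3 : ¬ P a → v = 0) :
    HasSum (fun n => if P n then f n else 0) v := by
  have h := hasSum_single (f := fun n => if P n then f n else 0) a (by
    intro b hb
    simp only [ite_eq_right_iff]
    intro hP
    exact absurd (h1 b hP) hb)
  by_cases hP : P a
  · simpa [hP, h2 hP] using h
  · simpa [hP, h3 hP] using h

theorem aux_qX {J : ℕ} (lam : ℝ) (μ : Fin J → ℕ → ℝ)
    (r : Option (Fin J) → Option (Fin J) → ℝ) (n m : Fin J → ℕ) :
    qX lam μ r n m = ∑ j : Fin J,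
      ((if m = n + eV (some j) then lam * r none (some j) else 0)
        + (if m + eV (some j) = n then μ j (n j) * r (some j) none else 0)
        + ∑ i : Fin J,
            if i ≠ j ∧ m + eV (some j) = n + eV (some i) then
              μ j (n j) * r (some j) (some i)
            else 0) := by
  unfold qX
  split_ifs with h
  · subst h
    symm
    apply Finset.sum_eq_zero
    intro j _
    have e1 : ¬ (n = n + eV (some j)) := fun h => by
      have := congrFun h j
      simp [eV] at this
    have e2 : ¬ (n + eV (some j) = n) := fun h => e1 h.symm
    rw [if_neg e1, if_neg e2, Finset.sum_eq_zero]
    · simp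
    intro i _
    rw [if_neg]
    rintro ⟨hi, h⟩
    have := congrFun h i
    simp [eV, hi] at this
  · rfl

theorem aux_sub {J : ℕ} (F : (Fin J → ℕ) → ℝ) (m : Fin J → ℕ) (h : F m = 0) (v : ℝ)
    (hs : HasSum F v) : ∑' n : {n : Fin J → ℕ // n ≠ m}, F n.1 = v := by
  rw [← hs.tsum_eq]
  apply tsum_subtype_eq_of_support_subset (s := {n | n ≠ m})
  intro n hn hnm
  exact hn (by rw [hnm, h])

theorem aux_out {J : ℕ} (lam : ℝ) (μ : Fin J → ℕ → ℝ) (hμ0 : ∀ j, μ j 0 = 0)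
    (r : Option (Fin J) → Option (Fin J) → ℝ) (m : Fin J → ℕ) :
    HasSum (fun n => qX lam μ r m n) (∑ j : Fin J,
      (lam * r none (some j) + μ j (m j) * r (some j) none
        + ∑ i : Fin J, if i ≠ j then μ j (m j) * r (some j) (some i) else 0)) := by
  simp_rw [aux_qX]
  refine hasSum_sum fun j _ => HasSum.add (HasSum.add ?_ ?_) (hasSum_sum fun i _ => ?_)
  · exact aux_single _ _ (m + eV (some j)) _ (fun n h => h) (fun _ => rfl) (fun h => absurd rfl h)
  · refine aux_single _ _ (m - eV (some j)) _ ?_ (fun _ => rfl) ?_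
    · rintro n rfl
      simp
    · intro h
      have : m j = 0 := by
        by_contra h0
        apply h
        funext x
        by_cases hx : x = j
        · subst hx; simp [eV]; omega
        · simp [eV, hx]
      simp [this, hμ0]
  · by_cases hij : i = j
    · simpa [hij] using (hasSum_zero : HasSum (fun _ : Fin J → ℕ => (0:ℝ)) 0)
    · refine aux_single _ _ (m + eV (some i) - eV (some j)) _ ?_ ?_ ?_
      · rintro n ⟨_, h⟩
        rw [← h]; simp
      · intro _; simp [hij]
      · intro h
        have : m j = 0 := by
          by_contra h0
          apply h
          refine ⟨hij, ?_⟩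
          funext x
          by_cases hx : x = j
          · subst hx; simp [eV]; omega
          · simp [eV, hx]
        simp [this, hμ0]

theorem aux_back {J : ℕ} (η : Fin J → ℝ) (hη : ∀ j, 0 < η j) (μ : Fin J → ℕ → ℝ)
    (hμpos : ∀ j k, k ≠ 0 → 0 < μ j k) (n m : Fin J → ℕ) (j : Fin J)
    (h : m = n + eV (some j)) : piX η μ n = piX η μ m * (μ j (m j) / η j) := by
  have := aux_step η μ hμpos n j
  have h1 : m j = n j + 1 := by rw [h]; simp [eV]
  rw [h1, h]
  have := (hη j).ne'
  field_simp
  linarith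

theorem aux_in {J : ℕ} (lam : ℝ) (μ : Fin J → ℕ → ℝ) (hμ0 : ∀ j, μ j 0 = 0)
    (hμpos : ∀ j k, k ≠ 0 → 0 < μ j k) (η : Fin J → ℝ) (hη : ∀ j, 0 < η j)
    (r : Option (Fin J) → Option (Fin J) → ℝ) (m : Fin J → ℕ) :
    HasSum (fun n => piX η μ n * qX lam μ r n m) (∑ j : Fin J,
      (piX η μ m * (μ j (m j) / η j) * (lam * r none (some j))
        + piX η μ m * η j * r (some j) none
        + ∑ i : Fin J, if i ≠ j then
            piX η μ m * (μ i (m i) / η i) * (η j * r (some j) (some i)) else 0)) := by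
  simp_rw [aux_qX, Finset.mul_sum, mul_add, Finset.mul_sum, mul_ite, mul_zero]
  have key : ∀ j, ¬ (m = (m - eV (some j)) + eV (some j)) → μ j (m j) = 0 := by
    intro j h
    have : m j = 0 := by
      by_contra h0
      apply h
      funext x
      by_cases hx : x = j
      · subst hx; simp [eV]; omega
      · simp [eV, hx]
    rw [this, hμ0]
  refine hasSum_sum fun j _ => HasSum.add (HasSum.add ?_ ?_) (hasSum_sum fun i _ => ?_)
  · refine aux_single _ _ (m - eV (some j)) _ ?_ ?_ ?_
    · rintro n h
      rw [h]; simp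
    · intro h
      rw [aux_back η hη μ hμpos _ m j h]
    · intro h
      rw [key j h]; simp
  · refine aux_single _ _ (m + eV (some j)) _ (fun n h => h.symm) ?_ (fun h => absurd rfl h)
    intro _
    have := aux_step η μ hμpos m j
    have e : (m + eV (some j)) j = m j + 1 := by simp [eV]
    rw [e, ← mul_assoc, this]; ring
  · by_cases hij : i = j
    · simpa [hij] using (hasSum_zero : HasSum (fun _ : Fin J → ℕ => (0:ℝ)) 0)
    · refine aux_single _ _ (m - eV (some i) + eV (some j)) _ ?_ ?_ ?_
      · rintro n ⟨_, h⟩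
        funext x
        have := congrFun h x
        by_cases hx : x = i
        · subst hx; simp [eV, hij] at this ⊢; omega
        · by_cases hx' : x = j
          · subst hx'; simp [eV, hx] at this ⊢; omega
          · simp [eV, hx, hx'] at this ⊢; omega
      · rintro ⟨_, h⟩
        rw [if_pos hij]
        have h' : m = m - eV (some i) + eV (some i) := by
          rw [add_right_comm] at h
          exact add_right_cancel h
        have e : (m - eV (some i) + eV (some j)) j = (m - eV (some i)) j + 1 := by simp [eV]
        rw [e, ← mul_assoc, aux_step η μ hμpos, aux_back η hη μ hμpos _ m i h']; ring
      · intro h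
        rw [key i]
        · simp
        · intro h'
          apply h
          refine ⟨hij, ?_⟩
          rw [add_right_comm, ← h']

/-- Jackson's theorem (stationarity of the product form): the
product measure `π` satisfies the global balance equations of the Jackson
network. -/
theorem jackson_global_balance
    (J : ℕ) (hJ : 1 ≤ J)
    (lam : ℝ) (hlam : 0 < lam)
    (μ : Fin J → ℕ → ℝ)
    (hμ0 : ∀ j, μ j 0 = 0)
    (hμpos : ∀ j k, k ≠ 0 → 0 < μ j k)
    (hμbdd : ∃ M : ℝ, ∀ j k, μ j k ≤ M)
    (r : Option (Fin J) → Option (Fin J) → ℝ)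
    (hrnn : ∀ i j, 0 ≤ r i j)
    (hrsto : ∀ i, ∑ j : Option (Fin J), r i j = 1)
    (η : Fin J → ℝ) (hη : ∀ j, 0 < η j)
    (htraffic : ∀ j : Fin J,
      η j = lam * r none (some j) + ∑ i : Fin J, η i * r (some i) (some j))
    (hC : ∀ j, Summable (fun k => prodK η μ j k)) :
    ∀ m : Fin J → ℕ,
      (∑' n : {n : Fin J → ℕ // n ≠ m}, piX η μ n.1 * qX lam μ r n.1 m)
        = piX η μ m * ∑' n : {n : Fin J → ℕ // n ≠ m}, qX lam μ r m n.1 := by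
  intro m
  rw [aux_sub (fun n => piX η μ n * qX lam μ r n m) m (by simp [qX]) _
      (aux_in lam μ hμ0 hμpos η hη r m),
    aux_sub (fun n => qX lam μ r m n) m (by simp [qX]) _ (aux_out lam μ hμ0 r m)]
  have split : ∀ (f : Fin J → ℝ) (j : Fin J),
      ∑ i, (if i ≠ j then f i else 0) = ∑ i, f i - f j := by
    intro f j
    rw [← Finset.sum_filter, Finset.filter_ne', ← Finset.sum_erase_add _ _ (Finset.mem_univ j)]
    ring
  have hout : ∀ j, r (some j) none + ∑ i, r (some j) (some i) = 1 := by
    intro j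
    rw [← hrsto (some j), Fintype.sum_option]
  have hout0 : ∑ j, η j * r (some j) none = lam * ∑ i, r none (some i) := by
    have h1 : ∑ j, η j * r (some j) none + ∑ j, ∑ i, η j * r (some j) (some i) = ∑ j, η j := by
      rw [← Finset.sum_add_distrib]
      refine Finset.sum_congr rfl fun j _ => ?_
      rw [← Finset.mul_sum, ← mul_add, hout, mul_one]
    have h2 : ∑ j, η j = lam * ∑ j, r none (some j)
        + ∑ j, ∑ i, η j * r (some j) (some i) := by
      rw [Finset.sum_comm, Finset.mul_sum, ← Finset.sum_add_distrib]
      exact Finset.sum_congr rfl fun j _ => htraffic j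
    linarith
  have hR : ∑ j : Fin J, (lam * r none (some j) + μ j (m j) * r (some j) none
        + ∑ i : Fin J, if i ≠ j then μ j (m j) * r (some j) (some i) else 0)
      = lam * ∑ j, r none (some j) + ∑ j, μ j (m j) * (1 - r (some j) (some j)) := by
    rw [Finset.mul_sum, ← Finset.sum_add_distrib]
    refine Finset.sum_congr rfl fun j _ => ?_
    rw [split (fun i => μ j (m j) * r (some j) (some i)) j, ← Finset.mul_sum, ← hout j]
    ring
  rw [hR, ← hout0, Finset.sum_add_distrib, Finset.sum_comm, ← Finset.sum_add_distrib,
    mul_add, Finset.mul_sum, Finset.mul_sum, ← Finset.sum_add_distrib]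
  refine Finset.sum_congr rfl fun j _ => ?_
  simp_rw [ne_comm (a := j)]
  rw [split (fun i => piX η μ m * (μ j (m j) / η j) * (η i * r (some i) (some j))) j,
    ← Finset.mul_sum]
  have h3 : ∑ i, η i * r (some i) (some j) = η j - lam * r none (some j) := by
    linarith [htraffic j]
  rw [h3]
  have := (hη j).ne'
  field_simp
  ring

end UnrelNet
end
end
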